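/- Let (X,Y) and (X',Y') be independent pairs of ℤ-valued random variables, where Y and Y' take values in {0,1} with P(Y=0) = α and P(Y'=0) = β, and H(X|Y) = H(X'|Y') = c < ∞. Suppose there is 0 ≤ δ ≤ 1/2 such that δ < α < 1−δ and δ < β < 1−δ. Then H(X+X' | Y,Y') − c ≥ δ²·g(c,c), where g(c,d) = (1/2) · min_{(x,y)∈[0,1]²} max( d·x − h₂(x) + c·y − h₂(y) , l(x,y) ), with l(x,y) = min_{(a,b)∈T(x,y)} ((1−x)²a² + (1−y)²b²)/(8 ln 2) and T(x,y) = {(a,b) ∈ ℝ₊² : a ≥ (4y−2)⁺, b ≥ (4x−2)⁺, a+b ≥ 2−x−y}. -/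

import Mathlib

open MeasureTheory ProbabilityTheory

/-- Binary entropy function (in bits), with the convention `0 * log₂ 0 = 0`. -/
noncomputable def H2 (x : ℝ) : ℝ := -(x * Real.logb 2 x) - (1 - x) * Real.logb 2 (1 - x)

/-- The constraint set `T(x,y) = {(a,b) ∈ ℝ₊² : a ≥ (4y−2)⁺, b ≥ (4x−2)⁺, a+b ≥ 2−x−y}`. -/
def Tset (x y : ℝ) : Set (ℝ × ℝ) :=
  {ab | 0 ≤ ab.1 ∧ 0 ≤ ab.2 ∧ max (4 * y - 2) 0 ≤ ab.1 ∧ max (4 * x - 2) 0 ≤ ab.2 ∧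
    2 - x - y ≤ ab.1 + ab.2}

/-- `l(x,y) = min_{(a,b) ∈ T(x,y)} ((1−x)²a² + (1−y)²b²)/(8 ln 2)`. -/
noncomputable def lfun (x y : ℝ) : ℝ :=
  sInf ((fun ab : ℝ × ℝ => ((1 - x) ^ 2 * ab.1 ^ 2 + (1 - y) ^ 2 * ab.2 ^ 2) / (8 * Real.log 2))
    '' Tset x y)

/-- `g(c,d) = (1/2)·min_{(x,y)∈[0,1]²} max( d·x − h₂(x) + c·y − h₂(y) , l(x,y) )`. -/
noncomputable def gNIID (c d : ℝ) : ℝ :=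
  (1 / 2) * sInf ((fun xy : ℝ × ℝ =>
      max (d * xy.1 - H2 xy.1 + c * xy.2 - H2 xy.2) (lfun xy.1 xy.2))
    '' (Set.Icc (0 : ℝ) 1 ×ˢ Set.Icc (0 : ℝ) 1))

/-- Probability of an event, as a real number. -/
noncomputable def pr {Ω : Type*} [MeasurableSpace Ω] (μ : Measure Ω) (A : Set Ω) : ℝ :=
  (μ A).toReal

/-- The `(k, b)`-summand of the conditional entropy `H(X|Y)` (in bits):
`−P(X=k, Y=b)·log₂( P(X=k, Y=b) / P(Y=b) )`. -/
noncomputable def condEntTerm {Ω β : Type*} [MeasurableSpace Ω] (μ : Measure Ω)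
    (X : Ω → ℤ) (Y : Ω → β) (kb : ℤ × β) : ℝ :=
  -(pr μ {ω | X ω = kb.1 ∧ Y ω = kb.2} *
    Real.logb 2 (pr μ {ω | X ω = kb.1 ∧ Y ω = kb.2} / pr μ {ω | Y ω = kb.2}))

/-- Conditional entropy `H(X|Y)` (in bits). -/
noncomputable def condEnt {Ω β : Type*} [MeasurableSpace Ω] (μ : Measure Ω)
    (X : Ω → ℤ) (Y : Ω → β) : ℝ :=
  ∑' kb : ℤ × β, condEntTerm μ X Y kb

/-- `H(X|Y) = c` with a convergent (finite) sum. -/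
def CondEntIs {Ω β : Type*} [MeasurableSpace Ω] (μ : Measure Ω)
    (X : Ω → ℤ) (Y : Ω → β) (c : ℝ) : Prop :=
  HasSum (condEntTerm μ X Y) c



structure FE (p : ℤ → ℝ) : Prop where
  nn : ∀ k, 0 ≤ p k
  hs : HasSum p 1
  ent : Summable fun k => Real.negMulLog (p k)

noncomputable def Ent (p : ℤ → ℝ) : ℝ := ∑' k, Real.negMulLog (p k)

noncomputable def cv (p q : ℤ → ℝ) (k : ℤ) : ℝ := ∑' j, p j * q (k - j)

lemma FE.le_one {p : ℤ → ℝ} (h : FE p) (k : ℤ) : p k ≤ 1 :=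
  le_hasSum h.hs k (fun j _ => h.nn j)

lemma FE.phi_nn {p : ℤ → ℝ} (h : FE p) (k : ℤ) : 0 ≤ Real.negMulLog (p k) :=
  Real.negMulLog_nonneg (h.nn k) (h.le_one k)

lemma FE.hasEnt {p : ℤ → ℝ} (h : FE p) : HasSum (fun k => Real.negMulLog (p k)) (Ent p) :=
  h.ent.hasSum

lemma cv_has {f g : ℤ → ℝ} {A B : ℝ} (hf : ∀ k, 0 ≤ f k) (hg : ∀ k, 0 ≤ g k)
    (hA : HasSum f A) (hB : HasSum g B) :
    (∀ k, HasSum (fun j => f j * g (k - j)) (cv f g k)) ∧ HasSum (cv f g) (A * B) := by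
  have h1 : Summable (fun x : ℤ × ℤ => f x.1 * g x.2) :=
    hA.summable.mul_of_nonneg hB.summable hf hg
  have h2 : HasSum (fun x : ℤ × ℤ => f x.1 * g x.2) (A * B) := hA.mul hB h1
  let e : ℤ × ℤ ≃ ℤ × ℤ :=
    { toFun := fun x => (x.2, x.1 - x.2)
      invFun := fun x => (x.1 + x.2, x.1)
      left_inv := fun x => by simp
      right_inv := fun x => by simp }
  have h3 : HasSum (fun x : ℤ × ℤ => f x.2 * g (x.1 - x.2)) (A * B) := by
    have := (e.hasSum_iff (f := fun x : ℤ × ℤ => f x.1 * g x.2)).2 h2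
    exact this
  have h4 : ∀ k, HasSum (fun j => f j * g (k - j)) (cv f g k) := fun k =>
    (h3.summable.prod_factor k).hasSum
  exact ⟨h4, h3.prod_fiberwise h4⟩

lemma cv_comm (p q : ℤ → ℝ) (k : ℤ) : cv p q k = cv q p k := by
  unfold cv
  rw [← (Equiv.subLeft k).tsum_eq]
  refine tsum_congr fun j => ?_
  simp [mul_comm]

lemma log_lower (t : ℝ) (ht : 0 < t) :
    (5 * t + 1) * (t - 1) / (2 * t * (t + 2)) ≤ Real.log t := by
  let F : ℝ → ℝ := fun t => Real.log t - (5 * t + 1) * (t - 1) / (2 * t * (t + 2))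
  have hd : ∀ t : ℝ, 0 < t → HasDerivAt F ((t - 1) ^ 3 / (t ^ 2 * (t + 2) ^ 2)) t := by
    intro t ht
    have h1 : HasDerivAt (fun t : ℝ => (5 * t + 1) * (t - 1)) (5 * (t - 1) + (5 * t + 1) * 1) t := by
      have a : HasDerivAt (fun t : ℝ => 5 * t + 1) 5 t := by
        simpa using ((hasDerivAt_id t).const_mul 5).add_const 1
      have b : HasDerivAt (fun t : ℝ => t - 1) 1 t := (hasDerivAt_id t).sub_const 1
      exact a.mul b
    have h2 : HasDerivAt (fun t : ℝ => (2 * t) * (t + 2)) (2 * (t + 2) + (2 * t) * 1) t := by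
      have a : HasDerivAt (fun t : ℝ => 2 * t) 2 t := by
        simpa using ((hasDerivAt_id t).const_mul 2)
      have b : HasDerivAt (fun t : ℝ => t + 2) 1 t := (hasDerivAt_id t).add_const 2
      exact a.mul b
    have hne : (2 * t) * (t + 2) ≠ 0 := by positivity
    have := (Real.hasDerivAt_log ht.ne').sub (h1.div h2 hne)
    refine this.congr_deriv ?_
    field_simp
    ring
  have h1 : F 1 = 0 := by simp [F]
  suffices 0 ≤ F t by simpa [F] using this
  rcases le_total t 1 with h | h
  · have : AntitoneOn F (Set.Ioc 0 1) := by
      apply antitoneOn_of_deriv_nonpos (convex_Ioc 0 1)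
      · exact fun x hx => (hd x hx.1).continuousAt.continuousWithinAt
      · exact fun x hx => (hd x (interior_subset hx).1).differentiableAt.differentiableWithinAt
      · intro x hx
        have hx := interior_subset hx
        rw [(hd x hx.1).deriv]
        apply div_nonpos_of_nonpos_of_nonneg _ (by positivity)
        have : x - 1 ≤ 0 := by linarith [hx.2]
        exact Odd.pow_nonpos (by decide) this
    have := this ⟨ht, h⟩ (by simp) h
    linarith
  · have : MonotoneOn F (Set.Ici 1) := by
      apply monotoneOn_of_deriv_nonneg (convex_Ici 1)
      · exact fun x hx => (hd x (by linarith [Set.mem_Ici.1 hx])).continuousAt.continuousWithinAt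
      · exact fun x hx => (hd x (by linarith [Set.mem_Ici.1 (interior_subset hx)])).differentiableAt.differentiableWithinAt
      · intro x hx
        have hx := Set.mem_Ici.1 (interior_subset hx)
        rw [(hd x (by linarith)).deriv]
        have : 0 ≤ x - 1 := by linarith
        positivity
    have := this (by simp) h h
    linarith

/-- pointwise Pinsker -/
lemma ptw (s r l : ℝ) (hs : 0 ≤ s) (hr : 0 ≤ r) (h0 : r = 0 → s = 0) :
    Real.negMulLog s + l * |s - r| - l ^ 2 * (s + 2 * r) / 6 ≤ - s * Real.log r + r - s := by
  rcases hr.eq_or_lt with h | hr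
  · subst h; simp [h0 rfl]
  have hw : 0 < s + 2 * r := by linarith
  have key : 3 / 2 * (s - r) ^ 2 / (s + 2 * r) ≤ s * Real.log s - s * Real.log r - s + r := by
    rcases hs.eq_or_lt with h | hs
    · subst h
      simp only [zero_mul, zero_sub, zero_add]
      rw [div_le_iff₀ (by linarith)]
      nlinarith
    have := log_lower (s / r) (by positivity)
    rw [Real.log_div hs.ne' hr.ne'] at this
    have h2 := mul_le_mul_of_nonneg_left this hs.le
    have h3 : s * ((5 * (s / r) + 1) * (s / r - 1) / (2 * (s / r) * (s / r + 2))) =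
      3 / 2 * (s - r) ^ 2 / (s + 2 * r) + s - r := by
      field_simp
      ring
    linarith
  have am : l * |s - r| - l ^ 2 * (s + 2 * r) / 6 ≤ 3 / 2 * (s - r) ^ 2 / (s + 2 * r) := by
    rw [le_div_iff₀ hw, ← sq_abs (s - r)]
    nlinarith [sq_nonneg (3 * |s - r| - l * (s + 2 * r))]
  simp only [Real.negMulLog]
  linarith

lemma FE_cv {p q : ℤ → ℝ} (hp : FE p) (hq : FE q) : FE (cv p q) := by
  obtain ⟨h1, h2⟩ := cv_has hp.nn hq.nn hp.hs hq.hs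
  have nn : ∀ k, 0 ≤ cv p q k := fun k => tsum_nonneg fun j => mul_nonneg (hp.nn _) (hq.nn _)
  have hs : HasSum (cv p q) 1 := by simpa using h2
  refine ⟨nn, hs, ?_⟩
  obtain ⟨a1, a2⟩ := cv_has hp.phi_nn hq.nn hp.hasEnt hq.hs
  obtain ⟨b1, b2⟩ := cv_has hp.nn hq.phi_nn hp.hs hq.hasEnt
  refine Summable.of_nonneg_of_le (fun k => Real.negMulLog_nonneg (nn k)
    (le_hasSum hs k fun j _ => nn j)) (fun k => ?_) (a2.add b2).summable
  have hR := (a1 k).add (b1 k)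
  have hL := (h1 k).mul_right (- Real.log (cv p q k))
  have e : Real.negMulLog (cv p q k) = cv p q k * - Real.log (cv p q k) := by
    simp [Real.negMulLog]
  rw [e]
  refine hasSum_le (fun j => ?_) hL hR
  have hle : p j * q (k - j) ≤ cv p q k :=
    le_hasSum (h1 k) j (fun i _ => mul_nonneg (hp.nn _) (hq.nn _))
  have hnn : 0 ≤ p j * q (k - j) := mul_nonneg (hp.nn _) (hq.nn _)
  have : Real.negMulLog (p j) * q (k - j) + p j * Real.negMulLog (q (k - j)) =
      Real.negMulLog (p j * q (k - j)) := by rw [Real.negMulLog_mul]; ring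
  rw [this]
  rcases hnn.eq_or_lt with h | h
  · simp [← h]
  · have := Real.log_le_log h hle
    simp only [Real.negMulLog]
    nlinarith

lemma Ent_cv_ge {p q : ℤ → ℝ} (hp : FE p) (hq : FE q) : Ent q ≤ Ent (cv p q) := by
  obtain ⟨h1, h2⟩ := cv_has hp.nn hq.nn hp.hs hq.hs
  obtain ⟨b1, b2⟩ := cv_has hp.nn hq.phi_nn hp.hs hq.hasEnt
  have hr := FE_cv hp hq
  rw [one_mul] at b2
  refine hasSum_le (fun k => ?_) b2 hr.hasEnt
  have hR := (((h1 k).mul_right (- Real.log (cv p q k))).add (hp.hs.mul_right (cv p q k))).sub (h1 k)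
  have e : cv p q k * - Real.log (cv p q k) + 1 * cv p q k - cv p q k =
    Real.negMulLog (cv p q k) := by simp [Real.negMulLog]
  rw [e] at hR
  refine hasSum_le (fun j => ?_) (b1 k) hR
  rcases (hp.nn j).eq_or_lt with h | h
  · simp [← h]
  have := ptw (q (k - j)) (cv p q k) 0 (hq.nn _) (hr.nn k) (fun h0 => by
    have : p j * q (k - j) ≤ cv p q k :=
      le_hasSum (h1 k) j (fun i _ => mul_nonneg (hp.nn _) (hq.nn _))
    rw [h0] at this
    have h3 := hq.nn (k - j)
    nlinarith)
  have := mul_le_mul_of_nonneg_left this h.le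
  ring_nf at this ⊢
  linarith

lemma Ent_cv_ge' {p q : ℤ → ℝ} (hp : FE p) (hq : FE q) : Ent p ≤ Ent (cv p q) := by
  have := Ent_cv_ge hq hp
  rwa [show cv q p = cv p q from funext fun k => cv_comm q p k] at this

lemma Ent_nn {p : ℤ → ℝ} (hp : FE p) : 0 ≤ Ent p := tsum_nonneg hp.phi_nn

lemma FE.abs_summable {p q : ℤ → ℝ} (hp : FE p) (hq : FE q) : Summable fun k => |p k - q k| :=
  (hp.hs.summable.sub hq.hs.summable).abs

lemma Ent_mix {P Q r : ℤ → ℝ} {A : ℝ} (hP : FE P) (hQ : FE Q) (hr : FE r) (hA0 : 0 ≤ A)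
    (hA1 : A ≤ 1) (h : ∀ k, r k = A * P k + (1 - A) * Q k) :
    A * Ent P + (1 - A) * Ent Q + A * (1 - A) * (∑' k, |P k - Q k|) ^ 2 / 2 ≤ Ent r := by
  set a := ∑' k, |P k - Q k| with ha
  have hsa : HasSum (fun k => |P k - Q k|) a := (hP.abs_summable hQ).hasSum
  have hL := (((hP.hasEnt.mul_left A).add (hQ.hasEnt.mul_left (1 - A))).add
    (hsa.mul_left (A * (1 - A) * a))).sub
    ((((hP.hs.add (hr.hs.mul_left 2)).mul_left (1 - A)).add
      ((hQ.hs.add (hr.hs.mul_left 2)).mul_left A)).mul_left (a ^ 2 * A * (1 - A) / 6))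
  have := hasSum_le (fun k => ?_) hL hr.hasEnt
  · refine le_trans (le_of_eq ?_) this
    ring
  have hPk := hP.nn k
  have hQk := hQ.nn k
  have hrk := hr.nn k
  have hk := h k
  rcases hA0.eq_or_lt with h0 | hA0
  · subst h0; simp [hk]
  rcases hA1.eq_or_lt with h0 | hA1
  · subst h0; simp [hk]
  have hB : 0 < 1 - A := by linarith
  have e1 := ptw (P k) (r k) ((1 - A) * a) hPk hrk (fun h0 => by
    rw [h0] at hk
    nlinarith [mul_nonneg hB.le hQk])
  have e2 := ptw (Q k) (r k) (A * a) hQk hrk (fun h0 => by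
    rw [h0] at hk
    nlinarith [mul_nonneg hA0.le hPk])
  have a1 : |P k - r k| = (1 - A) * |P k - Q k| := by
    rw [← abs_of_pos hB, ← abs_mul]; congr 1; rw [hk]; ring
  have a2 : |Q k - r k| = A * |P k - Q k| := by
    rw [abs_sub_comm (P k), ← abs_of_pos hA0, ← abs_mul]; congr 1; rw [hk]; ring
  rw [a1] at e1
  rw [a2] at e2
  have e1 := mul_le_mul_of_nonneg_left e1 hA0.le
  have e2 := mul_le_mul_of_nonneg_left e2 hB.le
  have e3 : Real.negMulLog (r k) = A * (-P k * Real.log (r k) + r k - P k) +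
      (1 - A) * (-Q k * Real.log (r k) + r k - Q k) := by
    have : Real.negMulLog (r k) = -(A * P k + (1 - A) * Q k) * Real.log (r k) := by
      rw [← hk]; rfl
    rw [this]
    linear_combination - hk
  rw [e3]
  refine le_trans (le_of_eq ?_) (add_le_add e1 e2)
  ring

lemma FE_single (i : ℤ) : FE (Pi.single i 1) := by
  refine ⟨fun k => ?_, hasSum_pi_single i 1, ?_⟩
  · by_cases h : k = i
    · subst h; simp
    · simp [h]
  · have : (fun k => Real.negMulLog ((Pi.single i 1 : ℤ → ℝ) k)) = fun _ => 0 := by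
      funext k
      by_cases h : k = i
      · subst h; simp
      · simp [h]
    rw [this]; exact summable_zero

lemma normalize_on (S : Set ℤ) {i : ℤ} (hi : i ∈ S) {p : ℤ → ℝ} (hp : FE p) {A : ℝ}
    (hA : HasSum (S.indicator p) A) :
    ∃ s, FE s ∧ (∀ k, k ∉ S → s k = 0) ∧ ∀ k, S.indicator p k = A * s k := by
  have hnn : ∀ k, 0 ≤ S.indicator p k := fun k => Set.indicator_nonneg (fun k _ => hp.nn k) k
  by_cases h0 : A = 0
  · subst h0
    refine ⟨Pi.single i 1, FE_single i, fun k hk => ?_, fun k => ?_⟩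
    · have : k ≠ i := fun h => hk (h ▸ hi)
      simp [this]
    · have := (hasSum_zero_iff_of_nonneg hnn).1 hA
      rw [this]; simp
  have hApos : 0 ≤ A := hA.nonneg hnn
  refine ⟨fun k => S.indicator p k * A⁻¹, ⟨fun k => mul_nonneg (hnn k) (by positivity), ?_, ?_⟩,
    fun k hk => by simp [hk], fun k => by field_simp⟩
  · have := hA.mul_right A⁻¹
    rwa [mul_inv_cancel₀ h0] at this
  · have e : (fun k => Real.negMulLog (S.indicator p k * A⁻¹)) = fun k =>
      A⁻¹ * S.indicator (fun k => Real.negMulLog (p k)) k +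
        S.indicator p k * Real.negMulLog A⁻¹ := by
      funext k
      rw [Real.negMulLog_mul]
      by_cases h : k ∈ S <;> simp [h]
    rw [e]
    exact ((hp.ent.indicator S).mul_left _).add (hA.summable.mul_right _)

noncomputable def G (m : ℤ) (P : ℤ → ℝ) : ℝ := ∑' k, (Set.Iic m).indicator P k

lemma G_has {P : ℤ → ℝ} (h : FE P) (m : ℤ) : HasSum ((Set.Iic m).indicator P) (G m P) :=
  (h.hs.summable.indicator _).hasSum

lemma G_nn {P : ℤ → ℝ} (h : FE P) (m : ℤ) : 0 ≤ G m P :=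
  (G_has h m).nonneg fun k => Set.indicator_nonneg (fun k _ => h.nn k) k

lemma G_le {P : ℤ → ℝ} (h : FE P) (m : ℤ) : G m P ≤ 1 :=
  hasSum_le (fun k => Set.indicator_le_self' (fun k _ => h.nn k) k) (G_has h m) h.hs

lemma G_lin {P Q r : ℤ → ℝ} {A B : ℝ} (hP : FE P) (hQ : FE Q) (m : ℤ)
    (h : ∀ k, r k = A * P k + B * Q k) : G m r = A * G m P + B * G m Q := by
  have := ((G_has hP m).mul_left A).add ((G_has hQ m).mul_left B)
  rw [← this.tsum_eq]
  refine tsum_congr fun k => ?_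
  by_cases hk : k ≤ m <;> simp [hk, h]

lemma G_one {P : ℤ → ℝ} (hP : FE P) (m : ℤ) (h : ∀ k, m < k → P k = 0) : G m P = 1 := by
  rw [← hP.hs.tsum_eq]
  refine tsum_congr fun k => ?_
  by_cases hk : k ≤ m
  · simp [hk]
  · simp [hk, h k (not_le.1 hk)]

lemma G_zero {P : ℤ → ℝ} (m : ℤ) (h : ∀ k, k ≤ m → P k = 0) : G m P = 0 := by
  unfold G
  have : (Set.Iic m).indicator P = fun _ => 0 := by
    funext k
    by_cases hk : k ≤ m
    · simp [hk, h k hk]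
    · simp [hk]
  rw [this]; simp

lemma G_abs {P Q : ℤ → ℝ} (hP : FE P) (hQ : FE Q) (m : ℤ) :
    2 * (G m P - G m Q) ≤ ∑' k, |P k - Q k| := by
  have h1 := (((G_has hP m).sub (G_has hQ m)).mul_left 2).sub (hP.hs.sub hQ.hs)
  have := hasSum_le (fun k => ?_) h1 (hP.abs_summable hQ).hasSum
  · linarith
  by_cases hk : k ≤ m
  · simp only [Set.mem_Iic, hk, Set.indicator_of_mem]
    linarith [le_abs_self (P k - Q k)]
  · simp only [Set.mem_Iic, hk, not_false_eq_true, Set.indicator_of_notMem]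
    linarith [neg_abs_le (P k - Q k)]

lemma cv_lin {p1 p2 p q : ℤ → ℝ} {A B : ℝ} (h1 : FE p1) (h2 : FE p2) (hq : FE q)
    (h : ∀ k, p k = A * p1 k + B * p2 k) (k : ℤ) :
    cv p q k = A * cv p1 q k + B * cv p2 q k := by
  have := (((cv_has h1.nn hq.nn h1.hs hq.hs).1 k).mul_left A).add
    (((cv_has h2.nn hq.nn h2.hs hq.hs).1 k).mul_left B)
  rw [← this.tsum_eq]
  refine tsum_congr fun j => ?_
  rw [h]; ring

lemma cv_lin' {p1 p2 p q : ℤ → ℝ} {A B : ℝ} (h1 : FE p1) (h2 : FE p2) (hq : FE q)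
    (h : ∀ k, p k = A * p1 k + B * p2 k) (k : ℤ) :
    cv q p k = A * cv q p1 k + B * cv q p2 k := by
  rw [cv_comm q p, cv_comm q p1, cv_comm q p2]
  exact cv_lin h1 h2 hq h k

lemma cv_supp_le {p q : ℤ → ℝ} {n m : ℤ} (hp : ∀ k, n < k → p k = 0) (hq : ∀ k, m < k → q k = 0)
    (k : ℤ) (hk : n + m < k) : cv p q k = 0 := by
  unfold cv
  rw [← tsum_zero (α := ℝ) (β := ℤ)]
  refine tsum_congr fun j => ?_
  by_cases h : n < j
  · simp [hp j h]
  · rw [hq (k - j) (by omega)]; simp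

lemma cv_supp_gt {p q : ℤ → ℝ} {n m : ℤ} (hp : ∀ k, k ≤ n → p k = 0) (hq : ∀ k, k < m → q k = 0)
    (k : ℤ) (hk : k ≤ n + m) : cv p q k = 0 := by
  unfold cv
  rw [← tsum_zero (α := ℝ) (β := ℤ)]
  refine tsum_congr fun j => ?_
  by_cases h : j ≤ n
  · simp [hp j h]
  · rw [hq (k - j) (by omega)]; simp

lemma exists_max {p : ℤ → ℝ} (hp : FE p) : ∃ i, ∀ k, p k ≤ p i := by
  have hex : ∃ i, 0 < p i := by
    by_contra! h
    have : HasSum p 0 := by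
      have e : p = fun _ => 0 := funext fun k => le_antisymm (h k) (hp.nn k)
      rw [e]; exact hasSum_zero
    have := this.unique hp.hs
    norm_num at this
  obtain ⟨i, hi⟩ := hex
  have ht := hp.hs.summable.tendsto_cofinite_zero
  rw [← Filter.cocompact_eq_cofinite] at ht
  exact (continuous_of_discreteTopology (f := p)).exists_forall_ge' i
    ((ht.eventually (gt_mem_nhds hi)).mono fun k hk => le_of_lt hk)

lemma peel {p : ℤ → ℝ} (hp : FE p) (i : ℤ) : ∃ s, FE s ∧
    (∀ k, p k = p i * (Pi.single i 1 : ℤ → ℝ) k + (1 - p i) * s k) ∧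
    Ent p = Real.negMulLog (p i) + Real.negMulLog (1 - p i) + (1 - p i) * Ent s := by
  have hA : HasSum (({i}ᶜ : Set ℤ).indicator p) (1 - p i) := by
    have := hp.hs.sub (hasSum_pi_single i (p i))
    have e : ({i}ᶜ : Set ℤ).indicator p = fun b => p b - (Pi.single i (p i) : ℤ → ℝ) b := by
      funext k
      by_cases h : k = i
      · subst h; simp
      · simp [h]
    rw [e]; exact this
  obtain ⟨s, hs, h0, h1⟩ := normalize_on ({i}ᶜ) (i := i + 1) (by simp) hp hA
  have hi : s i = 0 := h0 i (by simp)
  have hk : ∀ k, k ≠ i → p k = (1 - p i) * s k := fun k hk => by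
    rw [← h1]; simp [hk]
  refine ⟨s, hs, fun k => ?_, ?_⟩
  · by_cases h : k = i
    · subst h; simp [hi]
    · rw [hk k h]; simp [h]
  · have := ((hasSum_pi_single i (Real.negMulLog (p i))).add
      (hs.hs.mul_right (Real.negMulLog (1 - p i)))).add (hs.hasEnt.mul_left (1 - p i))
    rw [one_mul] at this
    rw [← this.tsum_eq]
    refine tsum_congr fun k => ?_
    by_cases h : k = i
    · subst h; simp [hi]
    · rw [hk k h, Real.negMulLog_mul]; simp [h]

lemma claimA {p q : ℤ → ℝ} (hp : FE p) (hq : FE q) (i : ℤ) :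
    p i * Ent q - (Real.negMulLog (p i) + Real.negMulLog (1 - p i)) ≤ Ent (cv p q) - Ent p := by
  obtain ⟨s, hs, h1, h2⟩ := peel hp i
  have hd := FE_single i
  have := Ent_mix (FE_cv hd hq) (FE_cv hs hq) (FE_cv hp hq) (hp.nn i) (hp.le_one i)
    (cv_lin hd hs hq h1)
  have e1 := mul_le_mul_of_nonneg_left (Ent_cv_ge hd hq) (hp.nn i)
  have hB : 0 ≤ 1 - p i := by linarith [hp.le_one i]
  have e2 := mul_le_mul_of_nonneg_left (Ent_cv_ge' hs hq) hB
  have e3 : 0 ≤ p i * (1 - p i) *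
      (∑' k, |cv (Pi.single i 1) q k - cv s q k|) ^ 2 / 2 := by
    have := hp.nn i
    positivity
  linarith

lemma split {p : ℤ → ℝ} (hp : FE p) {x : ℝ} (hx : ∀ k, p k ≤ x) :
    ∃ (A : ℝ) (n : ℤ) (p1 p2 : ℤ → ℝ), 0 ≤ A ∧ A ≤ 1 ∧ FE p1 ∧ FE p2 ∧
      (∀ k, n < k → p1 k = 0) ∧ (∀ k, k ≤ n → p2 k = 0) ∧
      (∀ k, p k = A * p1 k + (1 - A) * p2 k) ∧ |1 - 2 * A| ≤ x := by
  have hstep : ∀ n, G n p = G (n - 1) p + p n := by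
    intro n
    have := (G_has hp (n - 1)).add (hasSum_pi_single n (p n))
    rw [← this.tsum_eq]
    refine tsum_congr fun k => ?_
    rcases lt_trichotomy k n with h | h | h
    · simp [h.ne, h.le, Int.le_sub_one_iff.2 h]
    · subst h; simp
    · have h3 : ¬ k ≤ n - 1 := by omega
      simp [h.ne', h, h3]
  have hmono : ∀ m n, m ≤ n → G m p ≤ G n p := fun m n h =>
    hasSum_le (fun k => Set.indicator_le_indicator_of_subset (Set.Iic_subset_Iic.2 h) hp.nn k)
      (G_has hp m) (G_has hp n)
  obtain ⟨s, hs⟩ : ∃ s : Finset ℤ, 1 / 2 < ∑ k ∈ s, p k :=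
    (hp.hs.eventually (lt_mem_nhds (by norm_num : (1 / 2 : ℝ) < 1))).exists
  obtain ⟨u, hu⟩ := s.bddAbove
  obtain ⟨l, hl⟩ := s.bddBelow
  have h1 : 1 / 2 ≤ G u p := by
    have : ∑ k ∈ s, (Set.Iic u).indicator p k ≤ G u p :=
      sum_le_hasSum s (fun k _ => Set.indicator_nonneg (fun k _ => hp.nn k) k) (G_has hp u)
    rw [Finset.sum_congr rfl (fun k hk => Set.indicator_of_mem (Set.mem_Iic.2 (hu hk)) p)] at this
    linarith
  have h2 : G (l - 1) p < 1 / 2 := by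
    have h := hp.hs.sub (G_has hp (l - 1))
    have : ∑ k ∈ s, (p k - (Set.Iic (l - 1)).indicator p k) ≤ 1 - G (l - 1) p :=
      sum_le_hasSum s (fun k _ => sub_nonneg.2 (Set.indicator_le_self' (fun k _ => hp.nn k) k)) h
    have e : ∑ k ∈ s, (p k - (Set.Iic (l - 1)).indicator p k) = ∑ k ∈ s, p k := by
      refine Finset.sum_congr rfl fun k hk => ?_
      have : l ≤ k := hl hk
      have : ¬ k ≤ l - 1 := by omega
      simp [this]
    linarith
  obtain ⟨n, hn, hmin⟩ := Int.exists_least_of_bdd (P := fun n => 1 / 2 ≤ G n p)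
    ⟨l, fun z hz => by
      by_contra h
      have := hmono z (l - 1) (by omega)
      linarith⟩ ⟨u, h1⟩
  have hn' : G (n - 1) p < 1 / 2 := by
    by_contra! h
    have := hmin _ h
    omega
  obtain ⟨m, hm⟩ : ∃ m, |1 - 2 * G m p| ≤ x := by
    by_cases h : G n p ≤ (1 + x) / 2
    · exact ⟨n, abs_le.2 ⟨by linarith, by linarith [(hp.nn n).trans (hx n)]⟩⟩
    · have := hstep n
      have := hx n
      exact ⟨n - 1, abs_le.2 ⟨by linarith [(hp.nn n).trans (hx n)], by linarith⟩⟩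
  obtain ⟨p1, f1, z1, e1⟩ := normalize_on (Set.Iic m) (i := m) (by simp) hp (G_has hp m)
  have hc : HasSum ((Set.Ioi m).indicator p) (1 - G m p) := by
    have := hp.hs.sub (G_has hp m)
    have e : (Set.Ioi m).indicator p = fun b => p b - (Set.Iic m).indicator p b := by
      funext k
      by_cases hk : k ≤ m
      · simp [hk]
      · simp [hk, not_le.1 hk]
    rw [e]; exact this
  obtain ⟨p2, f2, z2, e2⟩ := normalize_on (Set.Ioi m) (i := m + 1) (by simp) hp hc
  refine ⟨G m p, m, p1, p2, G_nn hp m, G_le hp m, f1, f2, fun k hk => z1 k (by simpa using hk),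
    fun k hk => z2 k (by simpa using hk), fun k => ?_, hm⟩
  rw [← e1, ← e2]
  by_cases hk : k ≤ m
  · simp [hk]
  · simp [hk, not_le.1 hk]

lemma half {p q p1 p2 : ℤ → ℝ} {A x : ℝ} (hp : FE p) (hq : FE q) (h1 : FE p1) (h2 : FE p2)
    (hA0 : 0 ≤ A) (hA1 : A ≤ 1) (h : ∀ k, p k = A * p1 k + (1 - A) * p2 k)
    (hx : |1 - 2 * A| ≤ x) (hx1 : x ≤ 1) :
    (1 - x) ^ 2 * (∑' k, |cv p1 q k - cv p2 q k|) ^ 2 / 8 ≤ Ent (cv p q) - Ent q := by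
  have hm := Ent_mix (FE_cv h1 hq) (FE_cv h2 hq) (FE_cv hp hq) hA0 hA1 (cv_lin h1 h2 hq h)
  set a := ∑' k, |cv p1 q k - cv p2 q k|
  have e1 := mul_le_mul_of_nonneg_left (Ent_cv_ge h1 hq) hA0
  have e2 := mul_le_mul_of_nonneg_left (Ent_cv_ge h2 hq) (sub_nonneg.2 hA1)
  have hx0 : 0 ≤ x := (abs_nonneg _).trans hx
  have e3 : (1 - x) ^ 2 / 4 ≤ A * (1 - A) := by
    have : (1 - 2 * A) ^ 2 ≤ x ^ 2 := sq_le_sq' (by linarith [(abs_le.1 hx).1]) (abs_le.1 hx).2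
    nlinarith
  have e4 := mul_le_mul_of_nonneg_right e3 (sq_nonneg a)
  linarith

lemma big {p1 p2 q : ℤ → ℝ} {n : ℤ} (h1 : FE p1) (h2 : FE p2) (hq : FE q)
    (z1 : ∀ k, n < k → p1 k = 0) (z2 : ∀ k, k ≤ n → p2 k = 0) (j : ℤ) :
    4 * q j - 2 ≤ ∑' k, |cv p1 q k - cv p2 q k| := by
  obtain ⟨s, hs, e, -⟩ := peel hq j
  have hd := FE_single j
  have g := G_abs (FE_cv h1 hq) (FE_cv h2 hq) (n + j)
  have zd : ∀ k, j < k → (Pi.single j 1 : ℤ → ℝ) k = 0 := fun k hk => by simp [hk.ne']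
  have zd' : ∀ k, k < j → (Pi.single j 1 : ℤ → ℝ) k = 0 := fun k hk => by simp [hk.ne]
  have g1 := G_lin (FE_cv h1 hd) (FE_cv h1 hs) (n + j) (cv_lin' hd hs h1 e)
  have g2 := G_lin (FE_cv h2 hd) (FE_cv h2 hs) (n + j) (cv_lin' hd hs h2 e)
  rw [G_one (FE_cv h1 hd) _ (cv_supp_le z1 zd)] at g1
  rw [G_zero _ (cv_supp_gt z2 zd')] at g2
  have hB : 0 ≤ 1 - q j := by linarith [hq.le_one j]
  have i1 := mul_nonneg hB (G_nn (FE_cv h1 hs) (n + j))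
  have i2 := mul_le_mul_of_nonneg_left (G_le (FE_cv h2 hs) (n + j)) hB
  linarith

lemma claimB {p q : ℤ → ℝ} (hp : FE p) (hq : FE q) (i j : ℤ) (hi : ∀ k, p k ≤ p i)
    (hj : ∀ k, q k ≤ q j) :
    ∃ ab ∈ Tset (p i) (q j), ((1 - p i) ^ 2 * ab.1 ^ 2 + (1 - q j) ^ 2 * ab.2 ^ 2) / 8 ≤
      2 * Ent (cv p q) - Ent p - Ent q := by
  obtain ⟨A, n, p1, p2, hA0, hA1, f1, f2, z1, z2, e, hx⟩ := split hp hi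
  obtain ⟨B, m, q1, q2, hB0, hB1, k1, k2, y1, y2, e', hy⟩ := split hq hj
  have b1 := half hp hq f1 f2 hA0 hA1 e hx (hp.le_one i)
  have b2 := half hq hp k1 k2 hB0 hB1 e' hy (hq.le_one j)
  have c1 := big f1 f2 hq z1 z2 j
  have c2 := big k1 k2 hp y1 y2 i
  have g1 := G_abs (FE_cv f1 hq) (FE_cv f2 hq) (n + m)
  have g2 := G_abs (FE_cv k1 hp) (FE_cv k2 hp) (n + m)
  have n1 : 0 ≤ ∑' k, |cv p1 q k - cv p2 q k| := tsum_nonneg fun k => abs_nonneg _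
  have n2 : 0 ≤ ∑' k, |cv q1 p k - cv q2 p k| := tsum_nonneg fun k => abs_nonneg _
  rw [show cv q p = cv p q from funext fun k => cv_comm q p k] at b2
  refine ⟨(∑' k, |cv p1 q k - cv p2 q k|, ∑' k, |cv q1 p k - cv q2 p k|),
    ⟨n1, n2, max_le c1 n1, max_le c2 n2, ?_⟩, by simp only; linarith⟩
  simp only
  have l1 := G_lin (FE_cv f1 k1) (FE_cv f1 k2) (n + m) (cv_lin' k1 k2 f1 e')
  have l2 := G_lin (FE_cv f2 k1) (FE_cv f2 k2) (n + m) (cv_lin' k1 k2 f2 e')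
  have l3 := G_lin (FE_cv k1 f1) (FE_cv k1 f2) (n + m) (cv_lin' f1 f2 k1 e)
  have l4 := G_lin (FE_cv k2 f1) (FE_cv k2 f2) (n + m) (cv_lin' f1 f2 k2 e)
  rw [show cv q1 p1 = cv p1 q1 from funext fun k => cv_comm _ _ k,
    show cv q1 p2 = cv p2 q1 from funext fun k => cv_comm _ _ k] at l3
  rw [show cv q2 p1 = cv p1 q2 from funext fun k => cv_comm _ _ k,
    show cv q2 p2 = cv p2 q2 from funext fun k => cv_comm _ _ k] at l4
  have t1 : G (n + m) (cv p1 q1) = 1 := G_one (FE_cv f1 k1) _ (cv_supp_le z1 y1)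
  have t2 : G (n + m) (cv p2 q2) = 0 := G_zero _ (cv_supp_gt z2 fun k hk => y2 k hk.le)
  rw [t1] at l1 l3
  rw [t2] at l2 l4
  have u1 := G_nn (FE_cv f1 k2) (n + m)
  have u2 := G_le (FE_cv f1 k2) (n + m)
  have u3 := G_nn (FE_cv f2 k1) (n + m)
  have u4 := G_le (FE_cv f2 k1) (n + m)
  set U := G (n + m) (cv p1 q2)
  set V := G (n + m) (cv p2 q1)
  have hx' := abs_le.1 hx
  have hy' := abs_le.1 hy
  have key : 2 - p i - q j ≤ 2 * (A + B) + 2 * (1 - A - B) * (U + V) := by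
    rcases le_total 0 (1 - A - B) with h | h
    · have := mul_nonneg h (add_nonneg u1 u3)
      linarith
    · have := mul_nonneg_of_nonpos_of_nonpos h (by linarith : U + V - 2 ≤ 0)
      linarith
  rw [l1, l2] at g1
  rw [l3, l4] at g2
  linarith

lemma H2_eq (x : ℝ) : H2 x * Real.log 2 = Real.negMulLog x + Real.negMulLog (1 - x) := by
  have : Real.log 2 ≠ 0 := (Real.log_pos (by norm_num)).ne'
  unfold H2 Real.negMulLog Real.logb
  field_simp
  ring

lemma lfun_le {x y : ℝ} {ab : ℝ × ℝ} (h : ab ∈ Tset x y) :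
    lfun x y ≤ ((1 - x) ^ 2 * ab.1 ^ 2 + (1 - y) ^ 2 * ab.2 ^ 2) / (8 * Real.log 2) := by
  have hl : 0 < Real.log 2 := Real.log_pos (by norm_num)
  refine csInf_le ⟨0, ?_⟩ ⟨ab, h, rfl⟩
  rintro _ ⟨z, -, rfl⟩
  positivity

lemma lfun_nn (x y : ℝ) : 0 ≤ lfun x y := by
  have hl : 0 < Real.log 2 := Real.log_pos (by norm_num)
  refine Real.sInf_nonneg ?_
  rintro _ ⟨z, -, rfl⟩
  positivity

lemma g_nn (c d : ℝ) : 0 ≤ gNIID c d := by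
  refine mul_nonneg (by norm_num) (Real.sInf_nonneg ?_)
  rintro _ ⟨z, -, rfl⟩
  exact le_max_of_le_right (lfun_nn _ _)

lemma g_le {c d x y : ℝ} (hx : x ∈ Set.Icc (0 : ℝ) 1) (hy : y ∈ Set.Icc (0 : ℝ) 1) :
    gNIID c d ≤ 1 / 2 * max (d * x - H2 x + c * y - H2 y) (lfun x y) := by
  refine mul_le_mul_of_nonneg_left (csInf_le ⟨0, ?_⟩ ⟨(x, y), ⟨hx, hy⟩, rfl⟩) (by norm_num)
  rintro _ ⟨z, -, rfl⟩
  exact le_max_of_le_right (lfun_nn _ _)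

lemma niid {p q : ℤ → ℝ} (hp : FE p) (hq : FE q) (c : ℝ) (h1 : c ≤ Ent p / Real.log 2)
    (h2 : c ≤ Ent q / Real.log 2) :
    gNIID c c ≤ Ent (cv p q) / Real.log 2 - (Ent p / Real.log 2 + Ent q / Real.log 2) / 2 := by
  have hl : 0 < Real.log 2 := Real.log_pos (by norm_num)
  obtain ⟨i, hi⟩ := exists_max hp
  obtain ⟨j, hj⟩ := exists_max hq
  refine (g_le ⟨hp.nn i, hp.le_one i⟩ ⟨hq.nn j, hq.le_one j⟩).trans ?_
  suffices max (c * p i - H2 (p i) + c * q j - H2 (q j)) (lfun (p i) (q j)) ≤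
      (2 * Ent (cv p q) - Ent p - Ent q) / Real.log 2 by
    have e : (2 * Ent (cv p q) - Ent p - Ent q) / Real.log 2 = 2 * (Ent (cv p q) / Real.log 2) -
      Ent p / Real.log 2 - Ent q / Real.log 2 := by ring
    linarith
  refine max_le ?_ ?_
  · rw [le_div_iff₀ hl] at h1 h2 ⊢
    have a1 := claimA hp hq i
    have a2 := claimA hq hp j
    rw [show cv q p = cv p q from funext fun k => cv_comm q p k] at a2
    rw [← H2_eq] at a1 a2
    have b1 := mul_le_mul_of_nonneg_left h2 (hp.nn i)
    have b2 := mul_le_mul_of_nonneg_left h1 (hq.nn j)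
    linarith
  · obtain ⟨ab, hab, h⟩ := claimB hp hq i j hi hj
    refine (lfun_le hab).trans ?_
    rw [← div_div]
    exact div_le_div_of_nonneg_right h hl.le

lemma pos0 {p q : ℤ → ℝ} (hp : FE p) (hq : FE q) :
    0 ≤ Ent (cv p q) / Real.log 2 - (Ent p / Real.log 2 + Ent q / Real.log 2) / 2 := by
  have hl : 0 < Real.log 2 := Real.log_pos (by norm_num)
  have h1 := div_le_div_of_nonneg_right (Ent_cv_ge hp hq) hl.le
  have h2 := div_le_div_of_nonneg_right (Ent_cv_ge' hp hq) hl.le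
  linarith

lemma combine {p0 p1 q0 q1 : ℤ → ℝ} (f0 : FE p0) (f1 : FE p1) (k0 : FE q0) (k1 : FE q1)
    {α β c δ : ℝ} (hδ : 0 ≤ δ) (h1 : δ < α) (h2 : α < 1 - δ) (h3 : δ < β) (h4 : β < 1 - δ)
    (hc : α * (Ent p0 / Real.log 2) + (1 - α) * (Ent p1 / Real.log 2) = c)
    (hc' : β * (Ent q0 / Real.log 2) + (1 - β) * (Ent q1 / Real.log 2) = c) :
    δ ^ 2 * gNIID c c ≤ α * β * (Ent (cv p0 q0) / Real.log 2) +
      α * (1 - β) * (Ent (cv p0 q1) / Real.log 2) + (1 - α) * β * (Ent (cv p1 q0) / Real.log 2) +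
      (1 - α) * (1 - β) * (Ent (cv p1 q1) / Real.log 2) - c := by
  have n00 := pos0 f0 k0
  have n01 := pos0 f0 k1
  have n10 := pos0 f1 k0
  have n11 := pos0 f1 k1
  have m00 := niid f0 k0 c
  have m01 := niid f0 k1 c
  have m10 := niid f1 k0 c
  have m11 := niid f1 k1 c
  have hg := g_nn c c
  set g := gNIID c c
  set a := Ent p0 / Real.log 2
  set b := Ent p1 / Real.log 2
  set a' := Ent q0 / Real.log 2
  set b' := Ent q1 / Real.log 2
  set D00 := Ent (cv p0 q0) / Real.log 2
  set D01 := Ent (cv p0 q1) / Real.log 2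
  set D10 := Ent (cv p1 q0) / Real.log 2
  set D11 := Ent (cv p1 q1) / Real.log 2
  have e : α * β * D00 + α * (1 - β) * D01 + (1 - α) * β * D10 + (1 - α) * (1 - β) * D11 - c =
      α * β * (D00 - (a + a') / 2) + α * (1 - β) * (D01 - (a + b') / 2) +
      (1 - α) * β * (D10 - (b + a') / 2) + (1 - α) * (1 - β) * (D11 - (b + b') / 2) := by
    linear_combination (1 / 2) * hc + (1 / 2) * hc'
  rw [e]
  have w : ∀ u v t : ℝ, δ < u → δ < v → 0 ≤ t → 0 ≤ u * v * t := fun u v t hu hv ht =>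
    mul_nonneg (mul_nonneg (by linarith) (by linarith)) ht
  have w2 : ∀ u v t : ℝ, δ < u → δ < v → g ≤ t → δ ^ 2 * g ≤ u * v * t := fun u v t hu hv ht => by
    have : δ ^ 2 ≤ u * v := by nlinarith
    exact mul_le_mul this ht hg (by nlinarith)
  have h2' : δ < 1 - α := by linarith
  have h4' : δ < 1 - β := by linarith
  have x1 := w _ _ _ h1 h3 n00
  have x2 := w _ _ _ h1 h4' n01
  have x3 := w _ _ _ h2' h3 n10
  have x4 := w _ _ _ h2' h4' n11
  have hab : c ≤ a ∨ c ≤ b := by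
    by_contra! h
    nlinarith
  have hab' : c ≤ a' ∨ c ≤ b' := by
    by_contra! h
    nlinarith
  rcases hab with h | h <;> rcases hab' with h' | h'
  · linarith [w2 _ _ _ h1 h3 (m00 h h')]
  · linarith [w2 _ _ _ h1 h4' (m01 h h')]
  · linarith [w2 _ _ _ h2' h3 (m10 h h')]
  · linarith [w2 _ _ _ h2' h4' (m11 h h')]

lemma pr_part {Ω : Type*} [MeasurableSpace Ω] (μ : Measure Ω) [IsProbabilityMeasure μ]
    (Z : Ω → ℤ) (hZ : Measurable Z) (E : Set Ω) (hE : MeasurableSet E) :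
    HasSum (fun l => pr μ {ω | Z ω = l ∧ ω ∈ E}) (pr μ E) := by
  have hU : E = ⋃ l : ℤ, {ω | Z ω = l ∧ ω ∈ E} := by
    ext ω; simp
  have hm : ∀ l, MeasurableSet {ω | Z ω = l ∧ ω ∈ E} := fun l =>
    (hZ (measurableSet_singleton l)).inter hE
  have hd : Pairwise (Function.onFun Disjoint fun l : ℤ => {ω | Z ω = l ∧ ω ∈ E}) := by
    intro a b hab
    refine Set.disjoint_left.2 ?_
    rintro ω ⟨h1, -⟩ ⟨h2, -⟩
    exact hab (h1.symm.trans h2)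
  have h := measure_iUnion (μ := μ) hd hm
  rw [← hU] at h
  unfold pr
  rw [h]
  rw [ENNReal.tsum_toReal_eq (fun l => measure_ne_top μ _)]
  exact (ENNReal.summable_toReal (h ▸ measure_ne_top μ E)).hasSum

lemma term_eq {Ω β : Type*} [MeasurableSpace Ω] (μ : Measure Ω) (X : Ω → ℤ) (Y : Ω → β)
    (k : ℤ) (b : β) {w t : ℝ} (hw : pr μ {ω | Y ω = b} = w) (h0 : w ≠ 0)
    (ht : pr μ {ω | X ω = k ∧ Y ω = b} = w * t) :
    condEntTerm μ X Y (k, b) = w * (Real.negMulLog t / Real.log 2) := by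
  unfold condEntTerm
  simp only [hw, ht]
  rw [mul_div_cancel_left₀ _ h0]
  unfold Real.negMulLog Real.logb
  ring

lemma hasSum_slices {β : Type*} [DecidableEq β] (f : ℤ × β → ℝ) (S : Finset β) (h : β → ℝ)
    (h0 : ∀ k b, b ∉ S → f (k, b) = 0) (h1 : ∀ b ∈ S, HasSum (fun k => f (k, b)) (h b)) :
    HasSum f (∑ b ∈ S, h b) := by
  have e : f = fun kb => ∑ b ∈ S, (if kb.2 = b then f kb else 0) := by
    funext ⟨k, b⟩
    rw [Finset.sum_ite_eq]
    split_ifs with hb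
    · rfl
    · exact h0 k b hb
  rw [e]
  refine hasSum_sum fun b hb => ?_
  have inj : Function.Injective (fun k : ℤ => (k, b)) := fun x y hxy => (Prod.ext_iff.1 hxy).1
  refine (inj.hasSum_iff ?_).1 ?_
  · rintro ⟨k, b'⟩ hx
    have : b' ≠ b := fun h => hx ⟨k, by simp [h]⟩
    simp [this]
  · simpa [Function.comp_def] using h1 b hb

lemma fe_slice {Ω : Type*} [MeasurableSpace Ω] (μ : Measure Ω) [IsProbabilityMeasure μ]
    (X Y : Ω → ℤ) (hX : Measurable X) (hY : Measurable Y) (hs : Summable (condEntTerm μ X Y))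
    (b : ℤ) {w : ℝ} (hw : pr μ {ω | Y ω = b} = w) (h0 : 0 < w) :
    FE (fun k => pr μ {ω | X ω = k ∧ Y ω = b} / w) := by
  have hl : 0 < Real.log 2 := Real.log_pos (by norm_num)
  refine ⟨fun k => div_nonneg ENNReal.toReal_nonneg h0.le, ?_, ?_⟩
  · have := (pr_part μ X hX {ω | Y ω = b} (hY (measurableSet_singleton b))).div_const w
    rw [hw, div_self h0.ne'] at this
    exact this
  · have inj : Function.Injective (fun k : ℤ => (k, b)) := fun x y hxy => (Prod.ext_iff.1 hxy).1
    have h1 := (hs.comp_injective inj).mul_left (Real.log 2 / w)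
    refine h1.congr fun k => ?_
    have := term_eq μ X Y k b hw h0.ne' (t := pr μ {ω | X ω = k ∧ Y ω = b} / w) (by field_simp)
    simp only [Function.comp_apply]
    rw [this]
    field_simp

lemma pr_compl {Ω : Type*} [MeasurableSpace Ω] (μ : Measure Ω) [IsProbabilityMeasure μ]
    (Y : Ω → ℤ) (hY : Measurable Y) (h01 : ∀ ω, Y ω = 0 ∨ Y ω = 1) :
    pr μ {ω | Y ω = 1} = 1 - pr μ {ω | Y ω = 0} := by
  have e : {ω | Y ω = 1} = {ω | Y ω = 0}ᶜ := by
    ext ω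
    rcases h01 ω with h | h <;> simp [h]
  rw [e]
  exact probReal_compl_eq_one_sub (hY (measurableSet_singleton 0))

lemma cond_eq {Ω : Type*} [MeasurableSpace Ω] (μ : Measure Ω) [IsProbabilityMeasure μ]
    (X Y : Ω → ℤ) (hX : Measurable X) (hY : Measurable Y) (h01 : ∀ ω, Y ω = 0 ∨ Y ω = 1)
    {α c : ℝ} (hα : pr μ {ω | Y ω = 0} = α) (hα0 : 0 < α) (hα1 : α < 1)
    (hc : CondEntIs μ X Y c) :
    ∃ p : ℤ → ℤ → ℝ, FE (p 0) ∧ FE (p 1) ∧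
      (∀ k, pr μ {ω | X ω = k ∧ Y ω = 0} = α * p 0 k) ∧
      (∀ k, pr μ {ω | X ω = k ∧ Y ω = 1} = (1 - α) * p 1 k) ∧
      α * (Ent (p 0) / Real.log 2) + (1 - α) * (Ent (p 1) / Real.log 2) = c := by
  have hβ : pr μ {ω | Y ω = 1} = 1 - α := by rw [pr_compl μ Y hY h01, hα]
  have hα1' : 0 < 1 - α := by linarith
  have f0 := fe_slice μ X Y hX hY hc.summable 0 hα hα0
  have f1 := fe_slice μ X Y hX hY hc.summable 1 hβ hα1'
  have t0 : ∀ k, pr μ {ω | X ω = k ∧ Y ω = 0} = α * (pr μ {ω | X ω = k ∧ Y ω = 0} / α) :=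
    fun k => by field_simp
  have t1 : ∀ k, pr μ {ω | X ω = k ∧ Y ω = 1} =
      (1 - α) * (pr μ {ω | X ω = k ∧ Y ω = 1} / (1 - α)) :=
    fun k => by field_simp
  refine ⟨fun b k => if b = 0 then pr μ {ω | X ω = k ∧ Y ω = 0} / α else
    pr μ {ω | X ω = k ∧ Y ω = 1} / (1 - α), by simpa using f0, by simpa using f1,
    by simpa using t0, by simpa using t1, ?_⟩
  simp only [if_true, one_ne_zero, if_false]
  refine HasSum.unique ?_ hc
  have := hasSum_slices (condEntTerm μ X Y) {0, 1} (fun b => if b = 0 then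
    α * (Ent (fun k => pr μ {ω | X ω = k ∧ Y ω = 0} / α) / Real.log 2) else
    (1 - α) * (Ent (fun k => pr μ {ω | X ω = k ∧ Y ω = 1} / (1 - α)) / Real.log 2)) ?_ ?_
  · simpa using this
  · intro k b hb
    have : {ω | X ω = k ∧ Y ω = b} = ∅ := by
      ext ω
      simp only [Finset.mem_insert, Finset.mem_singleton, not_or] at hb
      simp only [Set.mem_setOf_eq, Set.mem_empty_iff_false, iff_false, not_and]
      intro _ h
      rcases h01 ω with h' | h' <;> rw [h'] at h
      · exact hb.1 h.symm
      · exact hb.2 h.symm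
    simp [condEntTerm, this, pr]
  · intro b hb
    simp only [Finset.mem_insert, Finset.mem_singleton] at hb
    rcases hb with rfl | rfl
    · simp only [if_true]
      rw [show (fun k => condEntTerm μ X Y (k, 0)) = _ from
        funext fun k => term_eq μ X Y k 0 hα hα0.ne' (t0 k)]
      exact (f0.hasEnt.div_const (Real.log 2)).mul_left α
    · simp only [one_ne_zero, if_false]
      rw [show (fun k => condEntTerm μ X Y (k, 1)) = _ from
        funext fun k => term_eq μ X Y k 1 hβ hα1'.ne' (t1 k)]
      exact (f1.hasEnt.div_const (Real.log 2)).mul_left (1 - α)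

lemma joint {Ω : Type*} [MeasurableSpace Ω] (μ : Measure Ω) [IsProbabilityMeasure μ]
    (X Y X' Y' : Ω → ℤ) (hX : Measurable X) (hY : Measurable Y)
    (hX' : Measurable X') (hY' : Measurable Y')
    (hindep : IndepFun (fun ω => (X ω, Y ω)) (fun ω => (X' ω, Y' ω)) μ) (i j : ℤ)
    {u v : ℝ} (p q : ℤ → ℝ) (hp : FE p) (hq : FE q) (hu : 0 < u) (hv : 0 < v)
    (h1 : ∀ k, pr μ {ω | X ω = k ∧ Y ω = i} = u * p k)
    (h2 : ∀ k, pr μ {ω | X' ω = k ∧ Y' ω = j} = v * q k) :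
    HasSum (fun k => condEntTerm μ (fun ω => X ω + X' ω) (fun ω => (Y ω, Y' ω)) (k, (i, j)))
      (u * v * (Ent (cv p q) / Real.log 2)) := by
  have hmeasS : Measurable fun ω => X ω + X' ω := hX.add hX'
  have hE : MeasurableSet {ω | (Y ω, Y' ω) = (i, j)} :=
    (hY.prodMk hY') (measurableSet_singleton (i, j))
  have hr := FE_cv hp hq
  have key : ∀ k, pr μ {ω | X ω + X' ω = k ∧ (Y ω, Y' ω) = (i, j)} = u * v * cv p q k := by
    intro k
    have hs := pr_part μ X hX {ω | X ω + X' ω = k ∧ (Y ω, Y' ω) = (i, j)}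
      ((hmeasS (measurableSet_singleton k)).inter hE)
    refine hs.unique ?_
    have := ((cv_has hp.nn hq.nn hp.hs hq.hs).1 k).mul_left (u * v)
    have e : (fun l => pr μ {ω | X ω = l ∧ ω ∈ {ω | X ω + X' ω = k ∧ (Y ω, Y' ω) = (i, j)}}) =
        fun l => u * v * (p l * q (k - l)) := by
      funext l
      have hset : {ω | X ω = l ∧ ω ∈ {ω | X ω + X' ω = k ∧ (Y ω, Y' ω) = (i, j)}} =
          (fun ω => (X ω, Y ω)) ⁻¹' {(l, i)} ∩ (fun ω => (X' ω, Y' ω)) ⁻¹' {(k - l, j)} := by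
        ext ω
        simp only [Set.mem_setOf_eq, Set.mem_inter_iff, Set.mem_preimage, Set.mem_singleton_iff,
          Prod.mk.injEq]
        constructor
        · rintro ⟨a, b, c, d⟩
          exact ⟨⟨a, c⟩, by omega, d⟩
        · rintro ⟨⟨a, c⟩, b, d⟩
          exact ⟨a, by omega, c, d⟩
      have hi := hindep.measure_inter_preimage_eq_mul {(l, i)} {(k - l, j)}
        (measurableSet_singleton _) (measurableSet_singleton _)
      have a1 := h1 l
      have a2 := h2 (k - l)
      rw [hset]
      unfold pr at a1 a2 ⊢
      rw [hi, ENNReal.toReal_mul]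
      have s1 : (fun ω => (X ω, Y ω)) ⁻¹' {(l, i)} = {ω | X ω = l ∧ Y ω = i} := by
        ext ω; simp
      have s2 : (fun ω => (X' ω, Y' ω)) ⁻¹' {(k - l, j)} = {ω | X' ω = k - l ∧ Y' ω = j} := by
        ext ω; simp
      rw [s1, s2, a1, a2]
      ring
    rw [e]; exact this
  have hw : pr μ {ω | (Y ω, Y' ω) = (i, j)} = u * v := by
    have := pr_part μ (fun ω => X ω + X' ω) hmeasS _ hE
    refine this.unique ?_
    have h3 := hr.hs.mul_left (u * v)
    rw [mul_one] at h3
    have e : (fun l => pr μ {ω | X ω + X' ω = l ∧ ω ∈ {ω | (Y ω, Y' ω) = (i, j)}}) =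
      fun l => u * v * cv p q l := funext fun l => key l
    rw [e]; exact h3
  have e : (fun k => condEntTerm μ (fun ω => X ω + X' ω) (fun ω => (Y ω, Y' ω)) (k, (i, j))) =
      fun k => u * v * (Real.negMulLog (cv p q k) / Real.log 2) := funext fun k =>
    term_eq μ _ _ k (i, j) hw (mul_pos hu hv).ne' (key k)
  rw [e]
  exact (hr.hasEnt.div_const _).mul_left _

/-- for independent pairs `(X,Y)`, `(X',Y')` with `Y, Y'` valued in `{0,1}`,
`P(Y=0) = α`, `P(Y'=0) = β`, `H(X|Y) = H(X'|Y') = c < ∞`, and `0 ≤ δ ≤ 1/2` with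
`δ < α < 1−δ` and `δ < β < 1−δ`, one has `H(X+X'|Y,Y') − c ≥ δ²·g(c,c)`. -/
theorem stmt18 {Ω : Type*} [MeasurableSpace Ω] (μ : Measure Ω) [IsProbabilityMeasure μ]
    (X Y X' Y' : Ω → ℤ) (hX : Measurable X) (hY : Measurable Y)
    (hX' : Measurable X') (hY' : Measurable Y')
    (hindep : IndepFun (fun ω => (X ω, Y ω)) (fun ω => (X' ω, Y' ω)) μ)
    (hY01 : ∀ ω, Y ω = 0 ∨ Y ω = 1) (hY'01 : ∀ ω, Y' ω = 0 ∨ Y' ω = 1)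
    (α β c δ : ℝ) (hα : pr μ {ω | Y ω = 0} = α) (hβ : pr μ {ω | Y' ω = 0} = β)
    (hc : CondEntIs μ X Y c) (hc' : CondEntIs μ X' Y' c)
    (hδ₀ : 0 ≤ δ) (hδ₁ : δ ≤ 1 / 2)
    (hδα : δ < α) (hαδ : α < 1 - δ) (hδβ : δ < β) (hβδ : β < 1 - δ) :
    condEnt μ (fun ω => X ω + X' ω) (fun ω => (Y ω, Y' ω)) - c ≥ δ ^ 2 * gNIID c c := by
  have hα0 : 0 < α := by linarith
  have hα1 : α < 1 := by linarith
  have hβ0 : 0 < β := by linarith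
  have hβ1 : β < 1 := by linarith
  have hα1' : 0 < 1 - α := by linarith
  have hβ1' : 0 < 1 - β := by linarith
  obtain ⟨p, f0, f1, a0, a1, hp⟩ := cond_eq μ X Y hX hY hY01 hα hα0 hα1 hc
  obtain ⟨q, k0, k1, b0, b1, hq⟩ := cond_eq μ X' Y' hX' hY' hY'01 hβ hβ0 hβ1 hc'
  have main := combine f0 f1 k0 k1 hδ₀ hδα hαδ hδβ hβδ hp hq
  have j00 := joint μ X Y X' Y' hX hY hX' hY' hindep 0 0 (p 0) (q 0) f0 k0 hα0 hβ0 a0 b0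
  have j01 := joint μ X Y X' Y' hX hY hX' hY' hindep 0 1 (p 0) (q 1) f0 k1 hα0 hβ1' a0 b1
  have j10 := joint μ X Y X' Y' hX hY hX' hY' hindep 1 0 (p 1) (q 0) f1 k0 hα1' hβ0 a1 b0
  have j11 := joint μ X Y X' Y' hX hY hX' hY' hindep 1 1 (p 1) (q 1) f1 k1 hα1' hβ1' a1 b1
  have hs := hasSum_slices (condEntTerm μ (fun ω => X ω + X' ω) (fun ω => (Y ω, Y' ω)))
    {(0, 0), (0, 1), (1, 0), (1, 1)}
    (fun b => ∑' k, condEntTerm μ (fun ω => X ω + X' ω) (fun ω => (Y ω, Y' ω)) (k, b)) ?_ ?_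
  · rw [Finset.sum_insert (by decide), Finset.sum_insert (by decide),
      Finset.sum_insert (by decide), Finset.sum_singleton,
      j00.tsum_eq, j01.tsum_eq, j10.tsum_eq, j11.tsum_eq] at hs
    unfold condEnt
    rw [hs.tsum_eq]
    linarith
  · intro k b hb
    have : {ω | X ω + X' ω = k ∧ (Y ω, Y' ω) = b} = ∅ := by
      ext ω
      simp only [Set.mem_setOf_eq, Set.mem_empty_iff_false, iff_false, not_and]
      intro _ h
      apply hb
      rw [← h]
      rcases hY01 ω with h1 | h1 <;> rcases hY'01 ω with h2 | h2 <;> simp [h1, h2]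
    simp [condEntTerm, this, pr]
  · intro b hb
    simp only [Finset.mem_insert, Finset.mem_singleton] at hb
    rcases hb with rfl | rfl | rfl | rfl
    · exact j00.summable.hasSum
    · exact j01.summable.hasSum
    · exact j10.summable.hasSum
    · exact j11.summable.hasSum
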